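/- Fix a real p > 1. Let G = (V, E) be a finite simple graph with |V| = n even and all edges of weight 1, and let C ≥ 0 be an integer. Set a := max{1, 8n³/(p−1), 2C+1} and b := 1 + max{1, (2an+C)^{p/(p−1)}, 3an}. Construct G' on vertex set V' := V ∪ {u, d, ℓ, r} with edge weights: weight 1 on each edge of E, weight a on each edge {v, x} for every v ∈ V and x ∈ {u, d, ℓ, r}, and weight b on the edge {u, d}; the terminal set is T := {u, d, ℓ, r}. Then there exists S ⊆ V with |S| = n/2 and |δ_G(S)| ≤ C if and only if there exists a partition (P_u, P_d, P_ℓ, P_r) of V' with u ∈ P_u, d ∈ P_d, ℓ ∈ P_ℓ, r ∈ P_r such that cut(P_u)^p + cut(P_d)^p + cut(P_ℓ)^p + cut(P_r)^p ≤ 2(b+an)^p + 2(2an+C)^p. -/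

import Mathlib

open Finset

/-- The cut value of `S ⊆ V` with respect to edge weights `w`. -/
noncomputable def cutval {V : Type*} [Fintype V] [DecidableEq V]
    (w : V → V → ℝ) (S : Finset V) : ℝ :=
  ∑ u ∈ S, ∑ v ∈ Sᶜ, w u v

/-- Edge weights of the graph `G'` in the reduction from graph bisection: original edges
have weight `1`; each original vertex is joined to each of the four new terminals
`u,d,ℓ,r` (encoded as `Sum.inr 0, 1, 2, 3`) with weight `a`; the edge `{u,d}` has
weight `b`. -/
noncomputable def wBis {V : Type*} (G : SimpleGraph V) [DecidableRel G.Adj] (a b : ℝ) :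
    (V ⊕ Fin 4) → (V ⊕ Fin 4) → ℝ
  | Sum.inl x, Sum.inl y => if G.Adj x y then 1 else 0
  | Sum.inl _, Sum.inr _ => a
  | Sum.inr _, Sum.inl _ => a
  | Sum.inr i, Sum.inr j => if (i = 0 ∧ j = 1) ∨ (i = 1 ∧ j = 0) then b else 0

/-- Number of ordered adjacent pairs leaving `S`, i.e. the size of the edge boundary of `S`. -/
noncomputable def edgeBoundary {V : Type*} [Fintype V] [DecidableEq V] (G : SimpleGraph V)
    [DecidableRel G.Adj] (S : Finset V) : ℝ :=
  ∑ x ∈ S, ∑ y ∈ Sᶜ, (if G.Adj x y then (1 : ℝ) else 0)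

lemma sum_wBis_inr {V : Type*} (G : SimpleGraph V) [DecidableRel G.Adj] (a b : ℝ)
    (i : Fin 4) :
    ∑ j ∈ {i}ᶜ, wBis G a b (Sum.inr i) (Sum.inr j) = if i = 0 ∨ i = 1 then b else 0 := by
  rw [show ({i}ᶜ : Finset (Fin 4)) = univ.erase i by ext; simp, sum_erase]
  · fin_cases i <;> simp [wBis]
  · fin_cases i <;> simp [wBis]

/-- A set containing exactly one terminal is determined by its non-terminal part. -/
lemma eq_toLeft_disjSum_singleton {V : Type*} {P : Finset (V ⊕ Fin 4)} {i : Fin 4}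
    (h : ∀ j, Sum.inr j ∈ P ↔ j = i) : P = P.toLeft.disjSum {i} := by
  ext (x | j) <;> simp [h]

section EdgeBoundary

variable {V : Type*} [Fintype V] [DecidableEq V] (G : SimpleGraph V) [DecidableRel G.Adj]

lemma edgeBoundary_nonneg (S : Finset V) : 0 ≤ edgeBoundary G S :=
  sum_nonneg fun _ _ => sum_nonneg fun _ _ => by split_ifs <;> norm_num

lemma edgeBoundary_compl (S : Finset V) : edgeBoundary G Sᶜ = edgeBoundary G S := by
  unfold edgeBoundary
  rw [compl_compl, sum_comm]
  simp only [G.adj_comm]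

lemma edgeBoundary_le (S : Finset V) : edgeBoundary G S ≤ S.card * Sᶜ.card := by
  have h : edgeBoundary G S ≤ ∑ x ∈ S, ∑ y ∈ Sᶜ, (1 : ℝ) :=
    sum_le_sum fun _ _ => sum_le_sum fun _ _ => by split_ifs <;> norm_num
  simpa using h

/-- Every graph of even order has a bisection, which cuts at most a quarter of `n ^ 2` edges. -/
lemma exists_bisection_edgeBoundary_le (h : Even (Fintype.card V)) :
    ∃ S : Finset V, 2 * S.card = Fintype.card V ∧
      edgeBoundary G S ≤ (Fintype.card V : ℝ) ^ 2 / 4 := by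
  obtain ⟨m, hm⟩ := h
  obtain ⟨S, -, hS⟩ := exists_subset_card_eq (s := (univ : Finset V)) (n := m)
    (by rw [card_univ]; omega)
  have hSc : Sᶜ.card = m := by rw [card_compl]; omega
  refine ⟨S, by omega, (edgeBoundary_le G S).trans ?_⟩
  rw [hS, hSc, hm]
  push_cast
  nlinarith

lemma cutval_disjSum_singleton (a b : ℝ) (S : Finset V) (i : Fin 4) :
    cutval (wBis G a b) (S.disjSum {i}) =
      (if i = 0 ∨ i = 1 then b else 0) + a * Fintype.card V + 2 * a * S.card
        + edgeBoundary G S := by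
  have hc : (S.disjSum {i})ᶜ = Sᶜ.disjSum ({i}ᶜ : Finset (Fin 4)) := by
    ext (x | j) <;> simp
  have h : ((Sᶜ.card : ℕ) : ℝ) = Fintype.card V - S.card := by
    rw [card_compl, Nat.cast_sub (card_le_univ S)]
  have h3 : ({i}ᶜ : Finset (Fin 4)).card = 3 := by simp [card_compl]
  unfold cutval
  simp only [hc, sum_disjSum, sum_singleton, sum_wBis_inr]
  simp only [wBis, sum_const, h3, nsmul_eq_mul, h, sum_add_distrib, edgeBoundary]
  push_cast
  ring

end EdgeBoundary

section Rpow

lemma rpow_add_mul_le_rpow_add {p x h : ℝ} (hp : 1 ≤ p) (hx : 0 < x) (hh : 0 ≤ x + h) :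
    x ^ p + p * h * x ^ (p - 1) ≤ (x + h) ^ p := by
  have hs : -1 ≤ h / x := by rw [le_div_iff₀ hx]; linarith
  have key := one_add_mul_self_le_rpow_one_add hs hp
  have e : x + h = x * (1 + h / x) := by field_simp
  rw [e, Real.mul_rpow hx.le (by linarith), Real.rpow_sub_one hx.ne']
  calc x ^ p + p * h * (x ^ p / x) = x ^ p * (1 + p * (h / x)) := by field_simp
    _ ≤ _ := by gcongr

/-- Second-order Taylor lower bound for `z ^ p` on `[0, 1]` when `1 ≤ p ≤ 2`. -/
lemma taylor_two_le_rpow {p z : ℝ} (hp : 1 ≤ p) (hp2 : p ≤ 2) (hz : 0 ≤ z) (hz1 : z ≤ 1) :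
    1 + p * (z - 1) + p * (p - 1) / 2 * (z - 1) ^ 2 ≤ z ^ p := by
  have hd : ∀ x : ℝ, HasDerivAt
      (fun z : ℝ => z ^ p - (1 + p * (z - 1) + p * (p - 1) / 2 * (z - 1) ^ 2))
      (p * x ^ (p - 1) - (p + p * (p - 1) * (x - 1))) x := fun x => by
    have h1 := Real.hasDerivAt_rpow_const (x := x) (p := p) (Or.inr hp)
    have h2 := (hasDerivAt_id x).sub_const 1
    refine (h1.sub (((h2.const_mul p).const_add 1).add
      ((h2.pow 2).const_mul (p * (p - 1) / 2)))).congr_deriv ?_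
    simp only [id_eq]
    push_cast
    ring
  have hanti := antitoneOn_of_deriv_nonpos (convex_Icc (0 : ℝ) 1)
    (fun x _ => (hd x).continuousAt.continuousWithinAt)
    (fun x _ => (hd x).differentiableAt.differentiableWithinAt) (fun x hx => by
      rw [interior_Icc] at hx
      rw [(hd x).deriv]
      have := rpow_one_add_le_one_add_mul_self (s := x - 1) (p := p - 1)
        (by linarith [hx.1]) (by linarith) (by linarith)
      rw [add_sub_cancel] at this
      nlinarith)
  have := hanti ⟨hz, hz1⟩ ⟨zero_le_one, le_rfl⟩ hz1
  simp at this
  linarith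

/-- Quadratic improvement of Bernoulli's inequality for exponents at least `2`. -/
lemma sq_bernoulli_le_rpow {p s : ℝ} (hp : 2 ≤ p) (hs : 0 ≤ s) :
    1 + p * s + p ^ 2 / 4 * s ^ 2 ≤ (1 + s) ^ p := by
  have h := one_add_mul_self_le_rpow_one_add (s := s) (p := p / 2) (by linarith) (by linarith)
  have e : (1 + s) ^ p = ((1 + s) ^ (p / 2)) ^ 2 := by
    rw [← Real.rpow_mul_natCast (by linarith)]; norm_num
  rw [e]
  calc _ = (1 + p / 2 * s) ^ 2 := by ring
    _ ≤ _ := by gcongr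

/-- A sufficiently unbalanced pair with slightly smaller mean has larger `p`-th power sum. -/
lemma two_mul_rpow_lt_add_rpow {p D c h : ℝ} (hp : 1 < p) (hD : 0 < D) (hc : 0 ≤ c)
    (hch : c ≤ h) (hhD : c + h ≤ D) (hgap : 8 * c * D < (p - 1) * (h - c) ^ 2) :
    2 * D ^ p < (D - c + h) ^ p + (D - c - h) ^ p := by
  have e1 : D - c + h = D * (1 + (h - c) / D) := by field_simp; ring
  have e2 : D - c - h = D * (1 + -((h + c) / D)) := by field_simp; ring
  have hs : 0 ≤ (h - c) / D := div_nonneg (by linarith) hD.le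
  have ht0 : 0 ≤ (h + c) / D := div_nonneg (by linarith) hD.le
  have ht1 : (h + c) / D ≤ 1 := by rw [div_le_one hD]; linarith
  have hdiff : (h + c) / D = (h - c) / D + 2 * (c / D) := by field_simp; ring
  have hgap' : 8 * (c / D) < (p - 1) * ((h - c) / D) ^ 2 := by
    have := div_lt_div_of_pos_right hgap (pow_pos hD 2)
    calc 8 * (c / D) = 8 * c * D / D ^ 2 := by field_simp
      _ < _ := this
      _ = _ := by rw [div_pow]; ring
  have hcD : 0 ≤ c / D := div_nonneg hc hD.le
  rw [e1, e2, Real.mul_rpow hD.le (by linarith), Real.mul_rpow hD.le (by linarith)]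
  generalize (h + c) / D = t at *
  generalize (h - c) / D = s at *
  generalize c / D = r at *
  have hDp : 0 < D ^ p := Real.rpow_pos_of_pos hD p
  suffices 2 < (1 + s) ^ p + (1 + -t) ^ p by nlinarith
  rcases le_total p 2 with hp2 | hp2
  · have h1 := one_add_mul_self_le_rpow_one_add (s := s) (p := p) (by linarith) hp.le
    have h2 := taylor_two_le_rpow (z := 1 + -t) hp.le hp2 (by linarith) (by linarith)
    have h3 : (p - 1) * s ^ 2 ≤ (p - 1) * t ^ 2 := by
      have : s ≤ t := by linarith
      gcongr
    have h4 : p * (8 * r) < p * ((p - 1) * t ^ 2) :=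
      mul_lt_mul_of_pos_left (by linarith) (by linarith)
    have h5 : 0 ≤ p * r := by positivity
    have h6 : p * t = p * s + 2 * (p * r) := by rw [hdiff]; ring
    nlinarith
  · have h1 := sq_bernoulli_le_rpow hp2 hs
    have h2 := one_add_mul_self_le_rpow_one_add (s := -t) (p := p) (by linarith) hp.le
    have h4 : p * (8 * r) < p * ((p - 1) * s ^ 2) := by gcongr
    have h6 : p * t = p * s + 2 * (p * r) := by rw [hdiff]; ring
    nlinarith [sq_nonneg s, mul_nonneg (by linarith : (0 : ℝ) ≤ p) (sq_nonneg s)]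

end Rpow

/-- Moving a vertex to the terminal of the heavy edge costs more than the whole light budget. -/
lemma heavy_rpow_lt {p b x M y : ℝ} (hp : 1 < p) (hM : 0 ≤ M) (hb : 0 < b)
    (hbM : M ^ (p / (p - 1)) < b) (hbx : b ≤ x) (hy : x + 2 ≤ y) :
    x ^ p + 2 * M ^ p < y ^ p := by
  have hp1 : 0 < p - 1 := by linarith
  have hx : 0 < x := by linarith
  have h1 : M ^ p < x ^ (p - 1) := by
    calc M ^ p = (M ^ (p / (p - 1))) ^ (p - 1) := by
          rw [← Real.rpow_mul hM, div_mul_cancel₀ _ hp1.ne']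
      _ < x ^ (p - 1) := Real.rpow_lt_rpow (Real.rpow_nonneg hM _) (by linarith) hp1
  have h2 := rpow_add_mul_le_rpow_add (p := p) (h := 2) hp.le hx (by linarith)
  have h3 : (x + 2) ^ p ≤ y ^ p := by gcongr
  have h4 : 0 ≤ M ^ p := Real.rpow_nonneg hM p
  nlinarith

/-- If both light parts carry all vertices but unequally many, the light budget is exceeded. -/
lemma unbalanced_rpow_lt {p a n C s t e f : ℝ} (hp : 1 < p) (hn : 1 ≤ n) (ha : 0 < a)
    (hC : 0 ≤ C) (han : 8 * n ^ 3 ≤ a * (p - 1)) (haC : 2 * C ≤ a) (hCn : 4 * C ≤ n ^ 2)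
    (hst : s + t = n) (ht : 0 ≤ t) (hlt : t + 2 ≤ s) (he : 0 ≤ e) (hf : 0 ≤ f) :
    2 * (2 * a * n + C) ^ p < (a * n + 2 * a * s + e) ^ p + (a * n + 2 * a * t + f) ^ p := by
  have hD : 0 < 2 * a * n + C := by positivity
  have hat : 0 ≤ a * t := by positivity
  have hh : 2 * a ≤ a * (s - t) := by nlinarith
  have hgap : 8 * C * (2 * a * n + C) < (p - 1) * (a * (s - t) - C) ^ 2 := by
    have h1 : (3 / 2 * a) ^ 2 ≤ (a * (s - t) - C) ^ 2 := by
      gcongr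
      linarith
    have h2 : (p - 1) * (3 / 2 * a) ^ 2 ≤ (p - 1) * (a * (s - t) - C) ^ 2 := by
      gcongr
    have h3 : 18 * (a * n ^ 3) ≤ (p - 1) * (3 / 2 * a) ^ 2 := by nlinarith
    have h4 : 2 * a * n + C ≤ 3 * (a * n) := by nlinarith
    have h5 : 8 * C * (2 * a * n + C) ≤ 2 * n ^ 2 * (3 * (a * n)) :=
      mul_le_mul (by linarith) h4 hD.le (by positivity)
    have h6 : 0 < a * n ^ 3 := by positivity
    nlinarith
  have key := two_mul_rpow_lt_add_rpow hp hD hC (by linarith : C ≤ a * (s - t))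
    (by rw [← hst]; nlinarith) hgap
  refine key.trans_le (add_le_add ?_ ?_)
  · refine Real.rpow_le_rpow (by nlinarith) ?_ (by linarith)
    rw [← hst]; nlinarith
  · refine Real.rpow_le_rpow ?_ ?_ (by linarith)
    · rw [← hst]; nlinarith
    · rw [← hst]; nlinarith

/-- Correctness of the reduction from graph bisection: `G` has a bisection cutting at most
`C` edges iff the instance `(G', w', {u,d,ℓ,r})` has a multiway cut whose `ℓ_p`-norm
objective value raised to the `p`-th power is at most `2(b+an)^p + 2(2an+C)^p`. -/
theorem bisection_reduction_correct {V : Type*} [Fintype V] [DecidableEq V]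
    (p : ℝ) (hp : 1 < p) (G : SimpleGraph V) [DecidableRel G.Adj] (C : ℕ)
    (n : ℝ) (hn : n = Fintype.card V) (hneven : Even (Fintype.card V))
    (a b : ℝ)
    (ha : a = max 1 (max (8 * n ^ 3 / (p - 1)) (2 * (C : ℝ) + 1)))
    (hb : b = 1 + max 1 (max ((2 * a * n + (C : ℝ)) ^ (p / (p - 1))) (3 * a * n))) :
    (∃ S : Finset V, 2 * S.card = Fintype.card V ∧
        (∑ x ∈ S, ∑ y ∈ Sᶜ, (if G.Adj x y then (1 : ℝ) else 0)) ≤ (C : ℝ)) ↔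
      (∃ Pu Pd Pl Pr : Finset (V ⊕ Fin 4),
        Sum.inr 0 ∈ Pu ∧ Sum.inr 1 ∈ Pd ∧ Sum.inr 2 ∈ Pl ∧ Sum.inr 3 ∈ Pr ∧
        Disjoint Pu Pd ∧ Disjoint Pu Pl ∧ Disjoint Pu Pr ∧
        Disjoint Pd Pl ∧ Disjoint Pd Pr ∧ Disjoint Pl Pr ∧
        Pu ∪ Pd ∪ Pl ∪ Pr = Finset.univ ∧
        cutval (wBis G a b) Pu ^ p + cutval (wBis G a b) Pd ^ p +
            cutval (wBis G a b) Pl ^ p + cutval (wBis G a b) Pr ^ p ≤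
          2 * (b + a * n) ^ p + 2 * (2 * a * n + (C : ℝ)) ^ p) := by
  change (∃ S : Finset V, 2 * S.card = Fintype.card V ∧ edgeBoundary G S ≤ (C : ℝ)) ↔ _
  have hC0 : (0 : ℝ) ≤ C := C.cast_nonneg
  have hn0 : 0 ≤ n := hn ▸ Nat.cast_nonneg _
  have ha1 : 1 ≤ a := ha ▸ le_max_left _ _
  have ha8 : 8 * n ^ 3 / (p - 1) ≤ a := ha ▸ (le_max_left _ _).trans (le_max_right _ _)
  have haC : 2 * (C : ℝ) + 1 ≤ a := ha ▸ (le_max_right _ _).trans (le_max_right _ _)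
  have hb0 : 0 < b := by
    have := le_max_left (1 : ℝ) (max ((2 * a * n + (C : ℝ)) ^ (p / (p - 1))) (3 * a * n))
    linarith
  have hbM : (2 * a * n + (C : ℝ)) ^ (p / (p - 1)) < b := by
    have h1 := le_max_right (1 : ℝ) (max ((2 * a * n + (C : ℝ)) ^ (p / (p - 1))) (3 * a * n))
    have h2 := le_max_left ((2 * a * n + (C : ℝ)) ^ (p / (p - 1))) (3 * a * n)
    linarith
  have han : 0 ≤ a * n := by positivity
  have hM : 0 ≤ 2 * a * n + (C : ℝ) := by positivity
  have hpp : 0 ≤ p := by linarith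
  constructor
  · rintro ⟨S, hS, hSC⟩
    have hSn : 2 * (S.card : ℝ) = n := by rw [hn]; exact_mod_cast hS
    have hScn : 2 * (Sᶜ.card : ℝ) = n := by
      rw [card_compl, Nat.cast_sub (card_le_univ S), ← hn]; linarith
    refine ⟨(∅ : Finset V).disjSum {0}, (∅ : Finset V).disjSum {1}, S.disjSum {2},
      Sᶜ.disjSum {3}, by simp, by simp, by simp, by simp, ?_, ?_, ?_, ?_, ?_, ?_, ?_, ?_⟩
    any_goals
      rw [Finset.disjoint_left]
      rintro (x | j) <;> simp +contextual
    · ext (x | j)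
      · simp [em]
      · fin_cases j <;> simp
    · simp only [cutval_disjSum_singleton, edgeBoundary_compl, ← hn]
      have h0 := edgeBoundary_nonneg G S
      have he : edgeBoundary G (∅ : Finset V) = 0 := by simp [edgeBoundary]
      have hl : (a * n + 2 * a * S.card + edgeBoundary G S) ^ p ≤ (2 * a * n + C) ^ p := by
        refine Real.rpow_le_rpow (by positivity) ?_ hpp
        rw [← hSn]; linarith
      have hr : (a * n + 2 * a * Sᶜ.card + edgeBoundary G S) ^ p ≤ (2 * a * n + C) ^ p := by
        refine Real.rpow_le_rpow (by positivity) ?_ hpp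
        rw [← hScn]; linarith
      simp [he]
      linarith
  · rintro ⟨Pu, Pd, Pl, Pr, hu, hd, hl, hr, dud, dul, dur, ddl, ddr, dlr, hU, hle⟩
    rcases le_or_gt (n ^ 2) (4 * C) with hbig | hsmall
    · obtain ⟨S, hS, hSC⟩ := exists_bisection_edgeBoundary_le G hneven
      exact ⟨S, hS, by rw [← hn] at hSC; linarith⟩
    rw [Finset.disjoint_left] at dud dul dur ddl ddr dlr
    have eu := eq_toLeft_disjSum_singleton (P := Pu) (i := 0) (by
      intro j; fin_cases j <;> grind)
    have ed := eq_toLeft_disjSum_singleton (P := Pd) (i := 1) (by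
      intro j; fin_cases j <;> grind)
    have el := eq_toLeft_disjSum_singleton (P := Pl) (i := 2) (by
      intro j; fin_cases j <;> grind)
    have er := eq_toLeft_disjSum_singleton (P := Pr) (i := 3) (by
      intro j; fin_cases j <;> grind)
    rw [eu, ed, el, er] at hle
    clear eu ed el er
    simp only [cutval_disjSum_singleton, ← hn] at hle
    simp at hle
    have nu := edgeBoundary_nonneg G Pu.toLeft
    have nd := edgeBoundary_nonneg G Pd.toLeft
    have nl := edgeBoundary_nonneg G Pl.toLeft
    have nr := edgeBoundary_nonneg G Pr.toLeft
    have hheavy : ∀ S : Finset V, (b + a * n) ^ p ≤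
        (b + a * n + 2 * a * S.card + edgeBoundary G S) ^ p := fun S => by
      have h0 := edgeBoundary_nonneg G S
      have h1 : 0 ≤ 2 * a * (S.card : ℝ) := by positivity
      exact Real.rpow_le_rpow (by linarith) (by linarith) hpp
    have hheavy' : ∀ S : Finset V, S ≠ ∅ → (b + a * n) ^ p + 2 * (2 * a * n + (C : ℝ)) ^ p <
        (b + a * n + 2 * a * S.card + edgeBoundary G S) ^ p := fun S hS => by
      have h0 := edgeBoundary_nonneg G S
      have h1 : (1 : ℝ) ≤ S.card := by exact_mod_cast (nonempty_iff_ne_empty.2 hS).card_pos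
      exact heavy_rpow_lt hp hM hb0 hbM (by linarith) (by nlinarith)
    have pl : 0 ≤ (a * n + 2 * a * Pl.toLeft.card + edgeBoundary G Pl.toLeft) ^ p := by positivity
    have pr : 0 ≤ (a * n + 2 * a * Pr.toLeft.card + edgeBoundary G Pr.toLeft) ^ p := by positivity
    have hVu : Pu.toLeft = ∅ := by
      by_contra h
      linarith [hheavy' _ h, hheavy Pd.toLeft]
    have hVd : Pd.toLeft = ∅ := by
      by_contra h
      linarith [hheavy' _ h, hheavy Pu.toLeft]
    have hlight : (a * n + 2 * a * Pl.toLeft.card + edgeBoundary G Pl.toLeft) ^ p +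
        (a * n + 2 * a * Pr.toLeft.card + edgeBoundary G Pr.toLeft) ^ p ≤
        2 * (2 * a * n + (C : ℝ)) ^ p := by
      linarith [hheavy Pu.toLeft, hheavy Pd.toLeft]
    have hcompl : Pr.toLeft = Pl.toLeftᶜ := by
      ext x
      have h1 : Sum.inl x ∈ Pu ∪ Pd ∪ Pl ∪ Pr := hU ▸ mem_univ _
      have h2 : Sum.inl x ∉ Pu := fun h => by simpa [hVu] using mem_toLeft.2 h
      have h3 : Sum.inl x ∉ Pd := fun h => by simpa [hVd] using mem_toLeft.2 h
      simp only [mem_union, h2, h3, false_or] at h1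
      simp only [mem_compl, mem_toLeft]
      exact ⟨fun h h' => dlr h' h, fun h => h1.resolve_left h⟩
    have hcard : Pl.toLeft.card + Pr.toLeft.card = Fintype.card V := by
      rw [hcompl, card_add_card_compl]
    have hcard' : (Pl.toLeft.card : ℝ) + Pr.toLeft.card = n := by
      rw [hn]; exact_mod_cast hcard
    have ha8' : 8 * n ^ 3 ≤ a * (p - 1) := (div_le_iff₀ (by linarith)).1 ha8
    have hunbal : ∀ S T : Finset V, (S.card : ℝ) + T.card = n → T.card + 2 ≤ S.card →
        2 * (2 * a * n + (C : ℝ)) ^ p < (a * n + 2 * a * S.card + edgeBoundary G S) ^ p +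
          (a * n + 2 * a * T.card + edgeBoundary G T) ^ p := fun S T hST hlt => by
      have hlt' : (T.card : ℝ) + 2 ≤ S.card := by exact_mod_cast hlt
      have hT : (0 : ℝ) ≤ T.card := Nat.cast_nonneg _
      exact unbalanced_rpow_lt hp (by linarith) (by linarith) hC0 ha8' (by linarith)
        hsmall.le hST hT hlt' (edgeBoundary_nonneg G S) (edgeBoundary_nonneg G T)
    have heq : Pl.toLeft.card = Pr.toLeft.card := by
      obtain ⟨m, hm⟩ := hneven
      rcases lt_trichotomy Pl.toLeft.card Pr.toLeft.card with h | h | h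
      · linarith [hunbal Pr.toLeft Pl.toLeft (by linarith) (by omega)]
      · exact h
      · linarith [hunbal Pl.toLeft Pr.toLeft hcard' (by omega)]
    refine ⟨Pl.toLeft, by omega, ?_⟩
    rw [← heq, hcompl, edgeBoundary_compl] at hlight
    rw [← heq] at hcard'
    by_contra! hlt
    have : (2 * a * n + (C : ℝ)) ^ p <
        (a * n + 2 * a * Pl.toLeft.card + edgeBoundary G Pl.toLeft) ^ p := by
      refine Real.rpow_lt_rpow hM ?_ (by linarith)
      rw [← hcard']
      linarith
    linarith
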